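/- Fix k ≥ 3. Let Γ_k = (ℤ/kℤ) × ℤ with generating set S_k = {(i,0) : i ∈ ℤ/kℤ, i ≠ 0} ∪ {(i,1) : i ∈ ℤ/kℤ, i ≠ 0,1} ∪ {(-i,-1) : i ∈ ℤ/kℤ, i ≠ 0,1}. Then the Borel chromatic number of the shift graph of (Γ_k,S_k) equals k. -/

import Mathlib

open Multiplicative

section Defs

variable {G : Type*} [Group G]

/-- The left shift action of `g : G` on `x : G → Bool` (`2^G` with `2 = Bool`):
`(g · x)(h) = x (g⁻¹ h)`. -/
def shiftMap (g : G) (x : G → Bool) : G → Bool := fun h => x (g⁻¹ * h)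

/-- The free part `F(2^G)` of the left shift action. -/
def FreePart (G : Type*) [Group G] : Set (G → Bool) :=
  {x | ∀ g : G, g ≠ 1 → shiftMap g x ≠ x}

/-- Adjacency in the shift graph of the marked group `(G, S)`: distinct `x, y ∈ F(2^G)`
are adjacent iff `y = s · x` for some `s ∈ S`. -/
def ShiftAdj (S : Set G) (x y : FreePart G) : Prop :=
  x ≠ y ∧ ∃ s ∈ S, (y : G → Bool) = shiftMap s (x : G → Bool)

/-- Adjacency in the Cayley graph of `(G, S)`: distinct `g, h` are adjacent iff
`h = s * g` for some `s ∈ S`. -/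
def CayleyAdj (S : Set G) (g h : G) : Prop :=
  g ≠ h ∧ ∃ s ∈ S, h = s * g

/-- `(G, S)` is a marked group: `S` is a finite symmetric generating set
not containing the identity. -/
def IsMarkedGroup (S : Set G) : Prop :=
  S.Finite ∧ (∀ s ∈ S, s⁻¹ ∈ S) ∧ (1 : G) ∉ S ∧ Subgroup.closure S = ⊤

end Defs

/-- A graph (given by its adjacency relation) has an `n`-coloring. -/
def HasColoring {X : Type*} (Adj : X → X → Prop) (n : ℕ) : Prop :=
  ∃ c : X → Fin n, ∀ x y, Adj x y → c x ≠ c y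

/-- The chromatic number: the least `n` admitting an `n`-coloring. -/
noncomputable def chromatic {X : Type*} (Adj : X → X → Prop) : ℕ :=
  sInf {n | HasColoring Adj n}

/-- A graph on a measurable space has a Borel `n`-coloring. -/
def HasBorelColoring {X : Type*} [MeasurableSpace X] (Adj : X → X → Prop) (n : ℕ) : Prop :=
  ∃ c : X → Fin n, Measurable c ∧ ∀ x y, Adj x y → c x ≠ c y

/-- The Borel chromatic number: the least `n` admitting a Borel `n`-coloring. -/
noncomputable def borelChromatic {X : Type*} [MeasurableSpace X] (Adj : X → X → Prop) : ℕ :=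
  sInf {n | HasBorelColoring Adj n}
/-- The marked group `Γ_k = ℤ/kℤ × ℤ` (written multiplicatively). -/
abbrev GammaK (k : ℕ) : Type := Multiplicative (ZMod k × ℤ)

/-- The generating set
`S_k = {(i,0) : i ≠ 0} ∪ {(i,1) : i ≠ 0,1} ∪ {(-i,-1) : i ≠ 0,1}` of `Γ_k`. -/
def SK (k : ℕ) : Set (GammaK k) :=
  {x | ∃ i : ZMod k, i ≠ 0 ∧ x = ofAdd (i, (0 : ℤ))} ∪
  {x | ∃ i : ZMod k, i ≠ 0 ∧ i ≠ 1 ∧ x = ofAdd (i, (1 : ℤ))} ∪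
  {x | ∃ i : ZMod k, i ≠ 0 ∧ i ≠ 1 ∧ x = ofAdd (-i, (-1 : ℤ))}

section Helpers

variable {G : Type*} [CommGroup G]

theorem shiftMap_mul (g h : G) (x : G → Bool) :
    shiftMap g (shiftMap h x) = shiftMap (g * h) x := by
  funext a
  simp only [shiftMap]
  congr 1
  rw [mul_inv_rev, mul_assoc]

theorem shiftMap_one (x : G → Bool) : shiftMap 1 x = x := by
  funext a
  simp [shiftMap]

/-- The action on the free part. -/
def actF (g : G) (x : FreePart G) : FreePart G :=
  ⟨shiftMap g x.1, by
    intro h hh heq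
    apply x.2 h hh
    have := congrArg (shiftMap g⁻¹) heq
    rw [shiftMap_mul, shiftMap_mul, shiftMap_mul, inv_mul_cancel, shiftMap_one] at this
    rwa [mul_comm g⁻¹ h, inv_mul_cancel_right] at this⟩

theorem actF_mul (g h : G) (x : FreePart G) : actF g (actF h x) = actF (g * h) x :=
  Subtype.ext (shiftMap_mul g h x.1)

theorem actF_one (x : FreePart G) : actF 1 x = x := Subtype.ext (shiftMap_one x.1)

theorem measurable_actF (g : G) : Measurable (actF g : FreePart G → FreePart G) := by
  apply Measurable.subtype_mk
  apply measurable_pi_lambda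
  intro a
  exact (measurable_pi_apply (g⁻¹ * a)).comp measurable_subtype_coe

theorem actF_free (g : G) (hg : g ≠ 1) (x : FreePart G) : actF g x ≠ x :=
  fun h => x.2 g hg (congrArg Subtype.val h)

/-- Greedy construction. -/
def greedy (F : Finset G) (V : ℕ → Set (FreePart G)) : ℕ → Set (FreePart G)
  | 0 => ∅
  | n + 1 => greedy F V n ∪ (V n \ ⋃ g ∈ F, (actF g) ⁻¹' (greedy F V n))

theorem greedy_meas (F : Finset G) (V : ℕ → Set (FreePart G)) (hV : ∀ n, MeasurableSet (V n))
    (n : ℕ) : MeasurableSet (greedy F V n) := by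
  induction n with
  | zero => exact MeasurableSet.empty
  | succ n ih =>
    exact ih.union ((hV n).diff (Finset.measurableSet_biUnion F
      (fun g _ => measurable_actF g ih)))

theorem greedy_mono (F : Finset G) (V : ℕ → Set (FreePart G)) : Monotone (greedy F V) :=
  monotone_nat_of_le_succ (fun _ => Set.subset_union_left)

theorem greedy_indep (F : Finset G) (hF : ∀ g ∈ F, g⁻¹ ∈ F) (V : ℕ → Set (FreePart G))
    (hV : ∀ n, ∀ x ∈ V n, ∀ g ∈ F, actF g x ∉ V n) (n : ℕ) :
    ∀ x ∈ greedy F V n, ∀ g ∈ F, actF g x ∉ greedy F V n := by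
  induction n with
  | zero => intro x hx; exact absurd hx (Set.notMem_empty x)
  | succ n ih =>
    intro x hx g hg hgx
    rcases hx with hx | ⟨hx, hx2⟩
    · rcases hgx with hgx | ⟨hgx, hgx2⟩
      · exact ih x hx g hg hgx
      · apply hgx2
        simp only [Set.mem_iUnion, Set.mem_preimage]
        refine ⟨g⁻¹, hF g hg, ?_⟩
        rwa [actF_mul, inv_mul_cancel, actF_one]
    · rcases hgx with hgx | ⟨hgx, hgx2⟩
      · apply hx2
        simp only [Set.mem_iUnion, Set.mem_preimage]
        exact ⟨g, hg, hgx⟩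
      · exact hV n x hx g hg hgx

/-- Basic clopen sets. -/
def cyl (D P : Finset G) : Set (FreePart G) := {x | ∀ h ∈ D, (x.1 h = true ↔ h ∈ P)}

theorem cyl_meas (D P : Finset G) : MeasurableSet (cyl D P) := by
  have : cyl D P = ⋂ h ∈ D, {x : FreePart G | (x.1 h = true ↔ h ∈ P)} := by
    ext x; simp [cyl]
  rw [this]
  refine Finset.measurableSet_biInter D (fun h _ => ?_)
  have hm : Measurable (fun x : FreePart G => x.1 h) :=
    (measurable_pi_apply h).comp measurable_subtype_coe
  exact hm (MeasurableSet.of_discrete (s := {b : Bool | b = true ↔ h ∈ P}))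

theorem exists_cyl (F : Finset G) (hF : (1 : G) ∉ F) (x : FreePart G) :
    ∃ D P : Finset G, x ∈ cyl D P ∧ ∀ y ∈ cyl D P, ∀ g ∈ F, actF g y ∉ cyl D P := by
  classical
  have h1 : ∀ g : G, ∃ h : G, g ∈ F → x.1 (g⁻¹ * h) ≠ x.1 h := by
    intro g
    by_cases hg : g ∈ F
    · have := x.2 g (fun h => hF (h ▸ hg))
      obtain ⟨h, hh⟩ := Function.ne_iff.1 this
      exact ⟨h, fun _ => hh⟩
    · exact ⟨1, fun h => absurd h hg⟩
  choose w hw using h1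
  let D := F.image w ∪ F.image (fun g => g⁻¹ * w g)
  refine ⟨D, D.filter (fun h => x.1 h = true), ?_, ?_⟩
  · intro h hh
    simp [hh]
  · intro y hy g hg hgy
    have ha : w g ∈ D := Finset.mem_union_left _ (Finset.mem_image_of_mem _ hg)
    have hb : g⁻¹ * w g ∈ D :=
      Finset.mem_union_right _ (Finset.mem_image_of_mem (fun g => g⁻¹ * w g) hg)
    have e1 := hy _ hb
    have e2 := hgy _ ha
    have e3 : (actF g y).1 (w g) = y.1 (g⁻¹ * w g) := rfl
    simp only [Finset.mem_filter, ha, hb, true_and] at e1 e2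
    rw [e3] at e2
    exact hw g hg (Bool.eq_iff_iff.2 (e1.symm.trans e2))

theorem exists_marker [Countable G] (F : Finset G) (h1 : (1 : G) ∉ F) (hF : ∀ g ∈ F, g⁻¹ ∈ F) :
    ∃ M : Set (FreePart G), MeasurableSet M ∧ (∀ x ∈ M, ∀ g ∈ F, actF g x ∉ M) ∧
      ∀ x, x ∈ M ∨ ∃ g ∈ F, actF g x ∈ M := by
  classical
  obtain ⟨e, he⟩ := exists_surjective_nat (Finset G × Finset G)
  let V : ℕ → Set (FreePart G) := fun n =>
    if ∀ y ∈ cyl (e n).1 (e n).2, ∀ g ∈ F, actF g y ∉ cyl (e n).1 (e n).2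
    then cyl (e n).1 (e n).2 else ∅
  have hVm : ∀ n, MeasurableSet (V n) := by
    intro n
    simp only [V]
    split_ifs
    · exact cyl_meas _ _
    · exact MeasurableSet.empty
  have hVi : ∀ n, ∀ x ∈ V n, ∀ g ∈ F, actF g x ∉ V n := by
    intro n
    simp only [V]
    split_ifs with h
    · exact h
    · intro x hx; exact absurd hx (Set.notMem_empty x)
  refine ⟨⋃ n, greedy F V n, MeasurableSet.iUnion (greedy_meas F V hVm), ?_, ?_⟩
  · intro x hx g hg hgx
    obtain ⟨n, hn⟩ := Set.mem_iUnion.1 hx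
    obtain ⟨m, hm⟩ := Set.mem_iUnion.1 hgx
    exact greedy_indep F hF V hVi (max n m) x (greedy_mono F V (le_max_left _ _) hn) g hg
      (greedy_mono F V (le_max_right _ _) hm)
  · intro x
    obtain ⟨D, P, hx, hDP⟩ := exists_cyl F h1 x
    obtain ⟨n, hn⟩ := he (D, P)
    have hxV : x ∈ V n := by
      simp only [V, hn]
      rw [if_pos hDP]
      exact hx
    by_cases hc : ∃ g ∈ F, actF g x ∈ greedy F V n
    · obtain ⟨g, hg, hgx⟩ := hc
      exact Or.inr ⟨g, hg, Set.mem_iUnion.2 ⟨n, hgx⟩⟩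
    · left
      refine Set.mem_iUnion.2 ⟨n + 1, Or.inr ⟨hxV, ?_⟩⟩
      simp only [Set.mem_iUnion, Set.mem_preimage]
      rintro ⟨g, hg, hgx⟩
      exact hc ⟨g, hg, hgx⟩

end Helpers

section Main

variable {k : ℕ}

/-- Action in additive coordinates. -/
def act2 (i : ZMod k) (m : ℤ) (x : FreePart (GammaK k)) : FreePart (GammaK k) :=
  actF (ofAdd (i, m)) x

theorem act2_act2 (i j : ZMod k) (m n : ℤ) (x : FreePart (GammaK k)) :
    act2 i m (act2 j n x) = act2 (i + j) (m + n) x := by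
  unfold act2
  rw [actF_mul, ← ofAdd_add]
  rfl

/-- `(i,p)·x` and `(j,q)·x` are the marker points surrounding `x`. -/
def Surr (M : Set (FreePart (GammaK k))) (x : FreePart (GammaK k))
    (t : ZMod k × ℤ × ZMod k × ℤ) : Prop :=
  t.2.1 ≤ 0 ∧ 0 < t.2.2.2 ∧ act2 t.1 t.2.1 x ∈ M ∧ act2 t.2.2.1 t.2.2.2 x ∈ M ∧
    ∀ (a : ZMod k) (m : ℤ), t.2.1 < m → m < t.2.2.2 → act2 a m x ∉ M

theorem Surr.measurable {M : Set (FreePart (GammaK k))} (hM : MeasurableSet M) [NeZero k]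
    (t : ZMod k × ℤ × ZMod k × ℤ) : MeasurableSet {x | Surr M x t} := by
  have hact : ∀ (a : ZMod k) (m : ℤ), MeasurableSet {x | act2 a m x ∈ M} :=
    fun a m => measurable_actF _ hM
  refine (MeasurableSet.const _).inter ((MeasurableSet.const _).inter
    ((hact _ _).inter ((hact _ _).inter ?_)))
  have : {x | ∀ (a : ZMod k) (m : ℤ), t.2.1 < m → m < t.2.2.2 → act2 a m x ∉ M} =
      ⋂ (a : ZMod k), ⋂ (m : ℤ), ⋂ (_ : t.2.1 < m), ⋂ (_ : m < t.2.2.2),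
        {x | act2 a m x ∈ M}ᶜ := by
    ext x; simp
  change MeasurableSet {x | ∀ (a : ZMod k) (m : ℤ), t.2.1 < m → m < t.2.2.2 → act2 a m x ∉ M}
  rw [this]
  exact MeasurableSet.iInter fun a => MeasurableSet.iInter fun m => MeasurableSet.iInter fun _ =>
    MeasurableSet.iInter fun _ => (hact a m).compl

theorem exists_marker2 [NeZero k] (N : ℤ) :
    ∃ M : Set (FreePart (GammaK k)), MeasurableSet M ∧
      (∀ x (i j : ZMod k) (m n : ℤ), act2 i m x ∈ M → act2 j n x ∈ M → |m - n| ≤ N →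
        i = j ∧ m = n) ∧
      ∀ x, ∃ (i : ZMod k) (m : ℤ), |m| ≤ |N| ∧ act2 i m x ∈ M := by
  classical
  let F : Finset (GammaK k) :=
    (((Finset.univ : Finset (ZMod k)) ×ˢ Finset.Icc (-N) N).image ofAdd).erase 1
  have hmem : ∀ (i : ZMod k) (m : ℤ), (ofAdd (i, m) : GammaK k) ∈ F ↔
      ¬ (i = 0 ∧ m = 0) ∧ |m| ≤ N := by
    intro i m
    have : (ofAdd (i, m) : GammaK k) = 1 ↔ (i = 0 ∧ m = 0) := by
      rw [ofAdd_eq_one, Prod.mk_eq_zero]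
    simp [F, this, abs_le]
  have : Countable (GammaK k) := inferInstanceAs (Countable (ZMod k × ℤ))
  obtain ⟨M, hM, hi, hmax⟩ := exists_marker F (by simp [F]) (by
    intro g hg
    obtain ⟨⟨i, m⟩, rfl⟩ := ofAdd.surjective g
    rw [← ofAdd_neg, Prod.neg_mk, hmem]
    rw [hmem] at hg
    simpa using hg)
  refine ⟨M, hM, ?_, ?_⟩
  · intro x i j m n h1 h2 h3
    by_contra hne
    have hF : (ofAdd (i - j, m - n) : GammaK k) ∈ F := by
      rw [hmem]
      refine ⟨?_, h3⟩
      rwa [sub_eq_zero, sub_eq_zero]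
    apply hi _ h2 _ hF
    change act2 _ _ (act2 _ _ _) ∈ M
    rw [act2_act2]
    simpa using h1
  · intro x
    rcases hmax x with h | ⟨g, hg, h⟩
    · refine ⟨0, 0, by simp, ?_⟩
      have : act2 0 0 x = x := actF_one x
      rwa [this]
    · obtain ⟨⟨i, m⟩, rfl⟩ := ofAdd.surjective g
      rw [hmem] at hg
      exact ⟨i, m, hg.2.trans (le_abs_self N), h⟩

/-- The color associated to the surrounding markers. -/
def colr (t : ZMod k × ℤ × ZMod k × ℤ) : ZMod k :=
  -t.1 - ((min (-t.2.1).toNat (t.2.2.1 - t.1).val : ℕ) : ZMod k)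

theorem hasBorelColoring_k (hk : 3 ≤ k) : HasBorelColoring (ShiftAdj (SK k)) k := by
  classical
  have : NeZero k := ⟨by omega⟩
  have : Fact (1 < k) := ⟨by omega⟩
  obtain ⟨M, hM, hind, hmax⟩ := exists_marker2 (k := k) (k : ℤ)
  have hlev : ∀ x (i j : ZMod k) (m : ℤ), act2 i m x ∈ M → act2 j m x ∈ M → i = j := by
    intro x i j m h1 h2
    exact (hind x i j m m h1 h2 (by simp)).1
  have huniq : ∀ x t t', Surr M x t → Surr M x t' → t = t' := by
    rintro x ⟨i, p, j, q⟩ ⟨i', p', j', q'⟩ ⟨h1, h2, h3, h4, h5⟩ ⟨h1', h2', h3', h4', h5'⟩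
    simp only at *
    have hp : p = p' := by
      rcases lt_trichotomy p p' with h | h | h
      · exact absurd h3' (h5 _ _ h (by omega))
      · exact h
      · exact absurd h3 (h5' _ _ h (by omega))
    have hq : q = q' := by
      rcases lt_trichotomy q q' with h | h | h
      · exact absurd h4 (h5' _ _ (by omega) h)
      · exact h
      · exact absurd h4' (h5 _ _ (by omega) h)
    subst hp hq
    rw [hlev x i i' p h3 h3', hlev x j j' q h4 h4']
  have hex : ∀ x, ∃ t, Surr M x t := by
    intro x
    have hlow : ∃ p : ℤ, p ≤ 0 ∧ ∃ i : ZMod k, act2 i p x ∈ M := by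
      obtain ⟨i, m, hm, h⟩ := hmax (act2 0 (-k) x)
      rw [act2_act2] at h
      have := abs_le.1 hm
      rw [Nat.abs_cast] at this
      exact ⟨_, by omega, _, h⟩
    have hup : ∃ q : ℤ, 0 < q ∧ ∃ i : ZMod k, act2 i q x ∈ M := by
      obtain ⟨i, m, hm, h⟩ := hmax (act2 0 (k + 1) x)
      rw [act2_act2] at h
      have := abs_le.1 hm
      rw [Nat.abs_cast] at this
      exact ⟨_, by omega, _, h⟩
    obtain ⟨p, ⟨hp, i, hi⟩, hpm⟩ := Int.exists_greatest_of_bdd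
      (P := fun p => p ≤ 0 ∧ ∃ i : ZMod k, act2 i p x ∈ M) ⟨0, fun z hz => hz.1⟩ hlow
    obtain ⟨q, ⟨hq, j, hj⟩, hqm⟩ := Int.exists_least_of_bdd
      (P := fun q => 0 < q ∧ ∃ i : ZMod k, act2 i q x ∈ M) ⟨0, fun z hz => le_of_lt hz.1⟩ hup
    refine ⟨(i, p, j, q), hp, hq, hi, hj, ?_⟩
    intro a m h1 h2 hm
    simp only at h1 h2
    rcases le_or_gt m 0 with h | h
    · exact absurd (hpm m ⟨h, a, hm⟩) (by omega)
    · exact absurd (hqm m ⟨h, a, hm⟩) (by omega)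
  choose t ht using hex
  have htm : Measurable t := by
    apply measurable_to_countable'
    intro s
    have : t ⁻¹' {s} = {x | Surr M x s} := by
      ext x
      constructor
      · intro h
        have h' : t x = s := h
        exact h' ▸ ht x
      · intro h
        exact huniq x _ _ (ht x) h
    rw [this]
    exact Surr.measurable hM s
  have hc0 : ∀ (a : ZMod k) x, a ≠ 0 → colr (t (act2 a 0 x)) ≠ colr (t x) := by
    intro a x ha
    have hx := ht x
    generalize t x = tx at hx ⊢
    obtain ⟨i, p, j, q⟩ := tx
    obtain ⟨h1, h2, h3, h4, h5⟩ := hx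
    simp only at *
    have hy : Surr M (act2 a 0 x) (i - a, p, j - a, q) := by
      refine ⟨h1, h2, ?_, ?_, ?_⟩
      · simpa [act2_act2] using h3
      · simpa [act2_act2] using h4
      · intro b m hb hb'
        rw [act2_act2, add_zero]
        exact h5 _ _ hb hb'
    rw [huniq _ _ _ (ht _) hy]
    simp only [colr, sub_sub_sub_cancel_right]
    intro h
    apply ha
    linear_combination h
  have hc1 : ∀ (a : ZMod k) x, a ≠ 0 → a ≠ 1 → colr (t (act2 a 1 x)) ≠ colr (t x) := by
    intro a x ha ha1
    have hx := ht x
    generalize t x = tx at hx ⊢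
    obtain ⟨i, p, j, q⟩ := tx
    obtain ⟨h1, h2, h3, h4, h5⟩ := hx
    simp only at *
    rcases (show 1 < q ∨ q = 1 by omega) with hq | hq
    · have hy : Surr M (act2 a 1 x) (i - a, p - 1, j - a, q - 1) := by
        refine ⟨by simp only; omega, by simp only; omega, ?_, ?_, ?_⟩
        · simpa [act2_act2] using h3
        · simpa [act2_act2] using h4
        · intro b m hb hb'
          rw [act2_act2]
          simp only at hb hb'
          exact h5 _ _ (by omega) (by omega)
      rw [huniq _ _ _ (ht _) hy]
      simp only [colr, sub_sub_sub_cancel_right]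
      have : min (-(p - 1)).toNat (j - i).val = min (-p).toNat (j - i).val ∨
        min (-(p - 1)).toNat (j - i).val = min (-p).toNat (j - i).val + 1 := by omega
      intro h
      rcases this with e | e
      · rw [e] at h
        apply ha
        linear_combination h
      · rw [e] at h
        push_cast at h
        apply ha1
        linear_combination h
    · subst hq
      have hval : (j - i).val < k := ZMod.val_lt _
      have hgap : ¬ |p - 1| ≤ (k : ℤ) := by
        intro h
        have := (hind x i j p 1 h3 h4 h).2
        omega
      have hmin : min (-p).toNat (j - i).val = (j - i).val := by
        rw [abs_of_neg (by omega)] at hgap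
        omega
      have hy := ht (act2 a 1 x)
      generalize t (act2 a 1 x) = ty at hy ⊢
      obtain ⟨i', p', j', q'⟩ := ty
      obtain ⟨h1', h2', h3', h4', h5'⟩ := hy
      simp only at *
      have hm : act2 (j - a) 0 (act2 a 1 x) ∈ M := by simpa [act2_act2] using h4
      have hp' : p' = 0 := by
        by_contra hne
        exact h5' _ _ (by omega) h2' hm
      subst hp'
      have hi' := hlev _ _ _ _ h3' hm
      subst hi'
      simp only [colr, hmin, ZMod.natCast_zmod_val]
      intro h
      simp at h
      apply ha
      linear_combination h
  let e : ZMod k ≃ Fin k := Fintype.equivFinOfCardEq (ZMod.card k)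
  refine ⟨fun x => e (colr (t x)), ?_, ?_⟩
  · exact (Measurable.of_discrete (f := fun s => e (colr s))).comp htm
  · rintro x y ⟨-, s, hs, hxy⟩ heq
    have heq' : colr (t x) = colr (t y) := e.injective heq
    rcases hs with (⟨i, hi, rfl⟩ | ⟨i, hi, hi1, rfl⟩) | ⟨i, hi, hi1, rfl⟩
    · have : y = act2 i 0 x := Subtype.ext hxy
      subst this
      exact hc0 i x hi heq'.symm
    · have : y = act2 i 1 x := Subtype.ext hxy
      subst this
      exact hc1 i x hi hi1 heq'.symm
    · have : y = act2 (-i) (-1) x := Subtype.ext hxy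
      have h2 : x = act2 i 1 y := by
        rw [this, act2_act2]
        rw [add_neg_cancel, add_neg_cancel]
        exact (actF_one x).symm
      rw [h2] at heq'
      exact hc1 i y hi hi1 heq'

theorem le_of_hasBorelColoring {n : ℕ} (hk : 3 ≤ k)
    (h : HasBorelColoring (ShiftAdj (SK k)) n) : k ≤ n := by
  classical
  have : NeZero k := ⟨by omega⟩
  obtain ⟨c, -, hc⟩ := h
  let x : FreePart (GammaK k) := ⟨fun g => decide (g = 1), by
    intro g hg h
    have := congrFun h g
    simp [shiftMap, hg] at this⟩
  have hinj : Function.Injective (fun i : ZMod k => c (act2 i 0 x)) := by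
    intro i j hij
    by_contra hne
    have hji : j - i ≠ 0 := sub_ne_zero.2 (Ne.symm hne)
    have he : act2 j 0 x = act2 (j - i) 0 (act2 i 0 x) := by
      rw [act2_act2]; simp
    refine hc (act2 i 0 x) (act2 j 0 x) ⟨?_, ofAdd (j - i, 0), ?_, ?_⟩ hij
    · intro h
      rw [he] at h
      refine actF_free _ ?_ _ h.symm
      intro h0
      rw [ofAdd_eq_one, Prod.mk_eq_zero] at h0
      exact hji h0.1
    · exact Or.inl (Or.inl ⟨_, hji, rfl⟩)
    · rw [he]; rfl
  have := Fintype.card_le_of_injective _ hinj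
  simpa [ZMod.card] using this

end Main

/-- For `k ≥ 3`, the Borel chromatic number of the shift graph of
`(Γ_k, S_k)` equals `k`. -/
theorem borelChromatic_shift_GammaK (k : ℕ) (hk : 3 ≤ k) :
    borelChromatic (ShiftAdj (SK k)) = k := by
  apply le_antisymm
  · exact Nat.sInf_le (hasBorelColoring_k hk)
  · exact le_csInf ⟨k, hasBorelColoring_k hk⟩ (fun n hn => le_of_hasBorelColoring hk hn)
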